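/- (Knebusch's Norm Principle for fields.) Let L/F be a finite field extension and q a regular quadratic form over F. Then N_{L/F}(D(q_L)) ⊆ D(q); that is, the field norm of any element of the subgroup of L^* generated by non-zero values of q over L lies in the subgroup of F^* generated by non-zero values of q over F. -/

import Mathlib

open scoped BigOperators

/-- `D(q)`: the subgroup of the units generated by the non-zero (hence invertible) values
of the quadratic form `q(x) = ∑ᵢⱼ M i j * x i * x j` with coefficient matrix `M`. -/
def valuesSubgroup {R : Type*} [CommRing R] {m : ℕ} (M : Matrix (Fin m) (Fin m) R) :
    Subgroup Rˣ :=
  Subgroup.closure {u : Rˣ | ∃ x : Fin m → R, (u : R) = ∑ i, ∑ j, M i j * x i * x j}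

open Polynomial IntermediateField

section QuadValue

/-- The value at `x` of the quadratic form with coefficient matrix `M`. -/
def quadValue {R ι : Type*} [CommRing R] [Fintype ι] (M : Matrix ι ι R) (x : ι → R) : R :=
  ∑ i, ∑ j, M i j * x i * x j

/-- The quadratic form with coefficient matrix `M` has no non-trivial zero. -/
def QuadAnisotropic {R ι : Type*} [CommRing R] [Fintype ι] (M : Matrix ι ι R) : Prop :=
  ∀ x : ι → R, quadValue M x = 0 → x = 0

variable {R S ι : Type*} [CommRing R] [CommRing S] [Fintype ι]

lemma map_quadValue (φ : R →+* S) (M : Matrix ι ι R) (x : ι → R) :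
    φ (quadValue M x) = quadValue (M.map φ) (fun i => φ (x i)) := by
  simp [quadValue]

lemma quadValue_mul_left (M : Matrix ι ι R) (a : R) (x : ι → R) :
    quadValue M (fun i => a * x i) = a ^ 2 * quadValue M x := by
  simp only [quadValue, Finset.mul_sum]
  exact Finset.sum_congr rfl fun i _ => Finset.sum_congr rfl fun j _ => by ring

@[simp] lemma quadValue_zero (M : Matrix ι ι R) : quadValue M (fun _ => 0) = 0 := by
  simp [quadValue]

lemma dvd_quadValue_sub_quadValue (M : Matrix ι ι R) {p : R} {x y : ι → R}
    (h : ∀ i, p ∣ x i - y i) : p ∣ quadValue M x - quadValue M y := by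
  simp only [quadValue, ← Finset.sum_sub_distrib]
  refine Finset.dvd_sum fun i _ => Finset.dvd_sum fun j _ => ?_
  have : M i j * x i * x j - M i j * y i * y j
      = (x i - y i) * (M i j * x j) + (x j - y j) * (M i j * y i) := by ring
  rw [this]
  exact dvd_add ((h i).mul_right _) ((h j).mul_right _)

lemma quadValue_smul_add (M : Matrix ι ι R) (a : R) (x y : ι → R) :
    quadValue M (a • x + y) =
      a ^ 2 * quadValue M x + a * (y ⬝ᵥ (M + M.transpose).mulVec x) + quadValue M y := by
  have h : y ⬝ᵥ (M + M.transpose).mulVec x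
      = ∑ i, ∑ j, (M i j * x i * y j + M i j * y i * x j) := by
    have h1 : y ⬝ᵥ M.transpose.mulVec x = ∑ i, ∑ j, M i j * x i * y j := by
      simp only [dotProduct, Matrix.mulVec, Finset.mul_sum, Matrix.transpose_apply]
      rw [Finset.sum_comm]
      exact Finset.sum_congr rfl fun i _ => Finset.sum_congr rfl fun j _ => by ring
    have h2 : y ⬝ᵥ M.mulVec x = ∑ i, ∑ j, M i j * y i * x j := by
      simp only [dotProduct, Matrix.mulVec, Finset.mul_sum]
      simp only [mul_comm, mul_left_comm]
    rw [Matrix.add_mulVec, dotProduct_add, h1, h2, add_comm]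
    simp only [Finset.sum_add_distrib]
  rw [h]
  simp only [quadValue, Finset.mul_sum, ← Finset.sum_add_distrib]
  refine Finset.sum_congr rfl fun i _ => Finset.sum_congr rfl fun j _ => ?_
  simp only [Pi.add_apply, Pi.smul_apply, smul_eq_mul]
  ring

lemma quadValue_fromBlocks_neg (M : Matrix ι ι R) (a : R) (y : ι → R) (t : R) :
    quadValue (Matrix.fromBlocks M 0 0 (Matrix.of fun _ _ : Unit => -a))
      (Sum.elim y fun _ => t) = quadValue M y - a * t ^ 2 := by
  simp [quadValue]
  ring

/-- A regular isotropic quadratic form over a field is universal. -/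
lemma exists_quadValue_eq_of_not_anisotropic {K : Type*} [Field K] [DecidableEq ι]
    {M : Matrix ι ι K} (hreg : (M + M.transpose).det ≠ 0) (hM : ¬ QuadAnisotropic M) (c : K) :
    ∃ x, quadValue M x = c := by
  simp only [QuadAnisotropic, not_forall] at hM
  obtain ⟨x, hx, hx0⟩ := hM
  have hne : (M + M.transpose).mulVec x ≠ 0 := fun h =>
    hreg (Matrix.exists_mulVec_eq_zero_iff.mp ⟨x, hx0, h⟩)
  obtain ⟨i, hi⟩ := Function.ne_iff.mp hne
  refine ⟨((c - quadValue M (Pi.single i 1)) / (M + M.transpose).mulVec x i) • x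
    + Pi.single i 1, ?_⟩
  rw [quadValue_smul_add, hx, single_dotProduct, one_mul, div_mul_cancel₀ _ hi]
  ring

end QuadValue

section PolynomialValues

variable {K ι : Type*} [Field K] [Fintype ι]

lemma natDegree_quadValue_le (M : Matrix ι ι K) {f : ι → K[X]} {d : ℕ}
    (hf : ∀ i, (f i).natDegree ≤ d) : (quadValue (M.map C) f).natDegree ≤ d + d := by
  refine natDegree_sum_le_of_forall_le _ _ fun i _ =>
    natDegree_sum_le_of_forall_le _ _ fun j _ => ?_
  rw [Matrix.map_apply, mul_assoc]
  exact (natDegree_C_mul_le _ _).trans (natDegree_mul_le_of_le (hf i) (hf j))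

lemma coeff_quadValue (M : Matrix ι ι K) {f : ι → K[X]} {d : ℕ}
    (hf : ∀ i, (f i).natDegree ≤ d) :
    (quadValue (M.map C) f).coeff (d + d) = quadValue M (fun i => (f i).coeff d) := by
  simp only [quadValue, finsetSum_coeff]
  refine Finset.sum_congr rfl fun i _ => Finset.sum_congr rfl fun j _ => ?_
  rw [Matrix.map_apply, mul_assoc, coeff_C_mul, coeff_mul_add_eq_of_natDegree_le (hf i) (hf j),
    mul_assoc]

lemma eval_quadValue (M : Matrix ι ι K) (f : ι → K[X]) (a : K) :
    (quadValue (M.map C) f).eval a = quadValue M (fun i => (f i).eval a) := by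
  simp [quadValue, eval_finsetSum]

lemma aeval_quadValue {A : Type*} [CommRing A] [Algebra K A] (M : Matrix ι ι K)
    (f : ι → K[X]) (a : A) :
    aeval a (quadValue (M.map C) f)
      = quadValue (M.map (algebraMap K A)) (fun i => aeval a (f i)) := by
  simp [quadValue]

lemma exists_natDegree_le_and_coeff_ne_zero {f : ι → K[X]} (hf : f ≠ 0) :
    ∃ i, (∀ j, (f j).natDegree ≤ (f i).natDegree) ∧
      (fun j => (f j).coeff (f i).natDegree) ≠ 0 := by
  classical
  obtain ⟨k, hk⟩ := Function.ne_iff.mp hf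
  obtain ⟨i, hi, hmax⟩ := Finset.exists_max_image (Finset.univ.filter fun j => f j ≠ 0)
    (fun j => (f j).natDegree) ⟨k, by simpa using hk⟩
  refine ⟨i, fun j => ?_, fun h => ?_⟩
  · by_cases hj : f j = 0
    · simp [hj]
    · exact hmax j (by simpa using hj)
  · have := congrFun h i
    simp_all

lemma exists_monic_irreducible_odd_factor {h : K[X]} (hh : Odd h.natDegree) :
    ∃ π : K[X], π.Monic ∧ Irreducible π ∧ Odd π.natDegree ∧ π ∣ h := by
  induction hn : h.natDegree using Nat.strong_induction_on generalizing h with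
  | _ n ih =>
    have h0 : h ≠ 0 := by rintro rfl; simp at hh
    obtain ⟨π, hm, hi, g, rfl⟩ := exists_monic_irreducible_factor h
      (not_isUnit_of_natDegree_pos _ hh.pos)
    have hg : g ≠ 0 := right_ne_zero_of_mul h0
    rw [natDegree_mul hm.ne_zero hg] at hn hh
    by_cases ho : Odd π.natDegree
    · exact ⟨π, hm, hi, ho, dvd_mul_right _ _⟩
    · have hgo : Odd g.natDegree := by
        rw [Nat.not_odd_iff_even] at ho
        exact (Nat.odd_add'.mp hh).mpr ho
      obtain ⟨ρ, h1, h2, h3, h4⟩ := ih _ (by have := hi.natDegree_pos; omega) hgo rfl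
      exact ⟨ρ, h1, h2, h3, h4.mul_left _⟩

lemma natDegree_modByMonic_lt_of_irreducible {p : K[X]} (hp : p.Monic) (hi : Irreducible p)
    (f : K[X]) : (f %ₘ p).natDegree < p.natDegree :=
  natDegree_modByMonic_lt f hp hi.ne_one

/-- Springer's theorem for simple extensions, in terms of polynomials. -/
lemma QuadAnisotropic.dvd_of_dvd_quadValue {M : Matrix ι ι K} (hM : QuadAnisotropic M)
    {p : K[X]} (hp : p.Monic) (hi : Irreducible p) (ho : Odd p.natDegree)
    {f : ι → K[X]} (hf : p ∣ quadValue (M.map C) f) (i : ι) : p ∣ f i := by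
  induction hn : p.natDegree using Nat.strong_induction_on generalizing p f i with
  | _ n ih =>
    have small : ∀ d < n, ∀ g : ι → K[X], (∀ i, (g i).natDegree ≤ d) →
        p ∣ quadValue (M.map C) g → g = 0 := by
      intro d
      induction d using Nat.strong_induction_on with
      | _ d ihd =>
        intro hd g hg hpg
        by_contra hg0
        obtain ⟨k, hk, hlead⟩ := exists_natDegree_le_and_coeff_ne_zero hg0
        set e := (g k).natDegree with he
        have hed : e ≤ d := hg k
        obtain ⟨h, hh⟩ := hpg
        have hc : (quadValue (M.map C) g).coeff (e + e) ≠ 0 := by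
          rw [coeff_quadValue M hk]
          exact fun h => hlead (hM _ h)
        have hdeg : (quadValue (M.map C) g).natDegree = e + e :=
          natDegree_eq_of_le_of_coeff_ne_zero (natDegree_quadValue_le M hk) hc
        have hh0 : h ≠ 0 := by rintro rfl; simp [hh] at hc
        rw [hh, natDegree_mul hp.ne_zero hh0] at hdeg
        have hho : Odd h.natDegree := by
          rw [Nat.odd_iff] at ho ⊢
          omega
        obtain ⟨π, hπm, hπi, hπo, hπh⟩ := exists_monic_irreducible_odd_factor hho
        have hπn : π.natDegree < n := by
          have := natDegree_le_of_dvd hπh hh0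
          omega
        have hπg : ∀ j, π ∣ g j := fun j =>
          ih _ hπn hπm hπi hπo (hh ▸ hπh.mul_left p) j rfl
        choose r hr using hπg
        have hg_eq : g = fun j => π * r j := funext hr
        have hpr : p ∣ quadValue (M.map C) r := by
          have h1 : p ∣ π ^ 2 * quadValue (M.map C) r := by
            rw [← quadValue_mul_left, ← hg_eq, hh]
            exact dvd_mul_right _ _
          refine (hi.prime.dvd_or_dvd h1).resolve_left fun h2 => ?_
          have := natDegree_le_of_dvd (hi.prime.dvd_of_dvd_pow h2) hπm.ne_zero
          omega
        have hπpos := hπi.natDegree_pos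
        have hrdeg : ∀ j, r j ≠ 0 → π.natDegree + (r j).natDegree ≤ d := fun j hj => by
          have := hg j
          rwa [hr, natDegree_mul hπm.ne_zero hj] at this
        have hr0 : r ≠ 0 := by
          rintro rfl
          exact hg0 (by rw [hg_eq]; ext; simp)
        obtain ⟨j, hj⟩ := Function.ne_iff.mp hr0
        have := hrdeg j hj
        refine hr0 (ihd (d - 1) (by omega) (by omega) r (fun l => ?_) hpr)
        by_cases hl : r l = 0
        · simp [hl]
        · have := hrdeg l hl
          omega
    have hlt := fun j => natDegree_modByMonic_lt_of_irreducible hp hi (f j)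
    have hmod : ∀ j, p ∣ f j %ₘ p - f j := fun j => by
      rw [modByMonic_eq_sub_mul_div]
      simp
    have h0 := small (n - 1) (by have := hi.natDegree_pos; omega) (fun j => f j %ₘ p)
      (fun j => by have := hlt j; omega) <| by
        have := dvd_quadValue_sub_quadValue (M.map C) hmod
        exact (dvd_iff_dvd_of_dvd_sub this).mpr hf
    exact (modByMonic_eq_zero_iff_dvd hp).mp (congrFun h0 i)

end PolynomialValues

section Springer

lemma QuadAnisotropic.map_powerBasis {K A ι : Type*} [Field K] [Field A] [Algebra K A]
    [Fintype ι] {M : Matrix ι ι K} (hM : QuadAnisotropic M) (pb : PowerBasis K A)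
    (ho : Odd pb.dim) : QuadAnisotropic (M.map (algebraMap K A)) := by
  intro x hx
  choose f hf using fun i => pb.exists_eq_aeval' (x i)
  have h_int := pb.isIntegral_gen
  have hdvd : minpoly K pb.gen ∣ quadValue (M.map C) f := by
    rw [minpoly.dvd_iff, aeval_quadValue, ← hx]
    simp only [← hf]
  funext i
  have := hM.dvd_of_dvd_quadValue (minpoly.monic h_int) (minpoly.irreducible h_int)
    (by rwa [pb.natDegree_minpoly]) hdvd i
  rw [hf]
  exact (minpoly.dvd_iff).mp this

/-- **Springer's theorem**: anisotropic quadratic forms stay anisotropic over odd degree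
extensions. -/
theorem QuadAnisotropic.map_of_odd_finrank {K L ι : Type*} [Field K] [Field L] [Algebra K L]
    [FiniteDimensional K L] [Fintype ι] {M : Matrix ι ι K} (hM : QuadAnisotropic M)
    (ho : Odd (Module.finrank K L)) : QuadAnisotropic (M.map (algebraMap K L)) := by
  have key : ∀ E : IntermediateField K L, QuadAnisotropic (M.map (algebraMap K E)) := by
    refine induction_on_adjoin _ ?_ ?_
    · intro x hx
      choose y hy using fun i => (botEquiv K L).symm.surjective (x i)
      obtain rfl : x = fun i => algebraMap K (⊥ : IntermediateField K L) (y i) :=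
        funext fun i => (hy i).symm
      rw [← map_quadValue, map_eq_zero] at hx
      funext i
      simpa using congrFun (hM _ hx) i
    · intro E x hE
      have h_int := IsIntegral.of_finite E x
      have hodd : Odd (adjoin.powerBasis h_int).dim := by
        rw [← PowerBasis.finrank]
        refine ho.of_dvd_nat ?_
        rw [← Module.finrank_mul_finrank K E L, ← Module.finrank_mul_finrank E E⟮x⟯ L]
        exact (dvd_mul_right _ _).mul_left _
      have := hE.map_powerBasis (adjoin.powerBasis h_int) hodd
      rw [Matrix.map_map] at this
      exact this
  intro x hx
  have := key ⊤ (fun i => ⟨x i, mem_top⟩) (Subtype.ext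
    ((map_quadValue (algebraMap (⊤ : IntermediateField K L) L) _ _).trans hx))
  funext i
  exact congrArg Subtype.val (congrFun this i)

end Springer

section Values

variable {F : Type*} [Field F] {m : ℕ}

/-- `c` is a unit lying in `valuesSubgroup M`. -/
def IsGroupValue (M : Matrix (Fin m) (Fin m) F) (c : F) : Prop :=
  ∃ w ∈ valuesSubgroup M, (w : F) = c

variable {M : Matrix (Fin m) (Fin m) F}

lemma isGroupValue_coe {w : Fˣ} : IsGroupValue M w ↔ w ∈ valuesSubgroup M :=
  ⟨fun ⟨_, hv, h⟩ => Units.ext h ▸ hv, fun h => ⟨w, h, rfl⟩⟩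

lemma IsGroupValue.ne_zero {c : F} (h : IsGroupValue M c) : c ≠ 0 := by
  obtain ⟨w, -, rfl⟩ := h
  exact w.ne_zero

lemma isGroupValue_one : IsGroupValue M 1 := ⟨1, one_mem _, rfl⟩

lemma IsGroupValue.mul {a b : F} (ha : IsGroupValue M a) (hb : IsGroupValue M b) :
    IsGroupValue M (a * b) := by
  obtain ⟨v, hv, rfl⟩ := ha
  obtain ⟨w, hw, rfl⟩ := hb
  exact ⟨v * w, mul_mem hv hw, rfl⟩

lemma IsGroupValue.pow {a : F} (ha : IsGroupValue M a) (n : ℕ) : IsGroupValue M (a ^ n) := by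
  obtain ⟨v, hv, rfl⟩ := ha
  exact ⟨v ^ n, pow_mem hv n, rfl⟩

lemma IsGroupValue.of_mul_right {a b : F} (hab : IsGroupValue M (a * b))
    (hb : IsGroupValue M b) : IsGroupValue M a := by
  have hb0 := hb.ne_zero
  obtain ⟨v, hv, h⟩ := hab
  obtain ⟨w, hw, rfl⟩ := hb
  refine ⟨v * w⁻¹, mul_mem hv (inv_mem hw), ?_⟩
  rw [Units.val_mul, h, Units.val_inv_eq_inv_val, mul_inv_cancel_right₀ hb0]

lemma isGroupValue_quadValue {x : Fin m → F} (hx : quadValue M x ≠ 0) :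
    IsGroupValue M (quadValue M x) :=
  ⟨Units.mk0 _ hx, Subgroup.subset_closure ⟨x, rfl⟩, rfl⟩

lemma isGroupValue_neg_one_pow_mul_coeff_zero {h : F[X]} (hlead : IsGroupValue M h.leadingCoeff)
    (hπ : ∀ π : F[X], π.Monic → Irreducible π → π ∣ h →
      IsGroupValue M ((-1) ^ π.natDegree * π.coeff 0)) :
    IsGroupValue M ((-1) ^ h.natDegree * h.coeff 0) := by
  induction hn : h.natDegree using Nat.strong_induction_on generalizing h with
  | _ n ih =>
    subst hn
    rcases Nat.eq_zero_or_pos h.natDegree with hd | hd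
    · rw [hd, pow_zero, one_mul]
      rwa [leadingCoeff, hd] at hlead
    · have h0 : h ≠ 0 := by rintro rfl; simp at hd
      obtain ⟨π, hm, hi, g, rfl⟩ := exists_monic_irreducible_factor h
        (not_isUnit_of_natDegree_pos _ hd)
      have hg : g ≠ 0 := right_ne_zero_of_mul h0
      have hdeg := natDegree_mul hm.ne_zero hg
      have h1 := hπ π hm hi (dvd_mul_right _ _)
      have h2 := ih g.natDegree (by have := hi.natDegree_pos; omega)
        (by rwa [leadingCoeff_mul, hm.leadingCoeff, one_mul] at hlead)
        (fun ρ hρ hρi hρg => hπ ρ hρ hρi (hρg.mul_left _)) rfl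
      rw [hdeg, pow_add, mul_coeff_zero, mul_mul_mul_comm]
      exact h1.mul h2

/-- Knebusch's norm principle for simple extensions, in terms of polynomials. -/
lemma QuadAnisotropic.isGroupValue_of_dvd (hM : QuadAnisotropic M) {p : F[X]} (hp : p.Monic)
    (hi : Irreducible p) (hp0 : p.coeff 0 ≠ 0) {f : Fin m → F[X]}
    (hf : p ∣ quadValue (M.map C) f - X) :
    IsGroupValue M ((-1) ^ p.natDegree * p.coeff 0) := by
  induction hn : p.natDegree using Nat.strong_induction_on generalizing p f with
  | _ n ih =>
    wlog hfn : ∀ i, (f i).natDegree < n generalizing f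
    · refine this (f := fun j => f j %ₘ p) ?_ fun j =>
        hn ▸ natDegree_modByMonic_lt_of_irreducible hp hi (f j)
      have hmod : ∀ j, p ∣ f j %ₘ p - f j := fun j => by
        rw [modByMonic_eq_sub_mul_div]
        simp
      have := dvd_add (dvd_quadValue_sub_quadValue (M.map C) hmod) hf
      rwa [sub_add_sub_cancel] at this
    have hpX : ¬ p ∣ X := fun h => by
      obtain ⟨g, hg⟩ := h
      rcases (irreducible_X (R := F)).isUnit_or_isUnit hg with h1 | h1
      · exact hi.not_isUnit h1
      · obtain ⟨c, hc, rfl⟩ := isUnit_iff.mp h1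
        have := congrArg (coeff · 0) hg
        simp [hp0, hc.ne_zero] at this
    have hf0 : f ≠ 0 := by
      rintro rfl
      refine hpX ?_
      have h0 : quadValue (M.map C) (0 : Fin m → F[X]) = 0 := quadValue_zero _
      rwa [h0, zero_sub, dvd_neg] at hf
    obtain ⟨k, hk, hlead⟩ := exists_natDegree_le_and_coeff_ne_zero hf0
    set d := (f k).natDegree with hd
    have hdn : d < n := hfn k
    have hc0 : quadValue M (fun i => (f i).coeff d) ≠ 0 := fun h => hlead (hM _ h)
    have hcG := coeff_quadValue M hk
    have hdegle := natDegree_quadValue_le M hk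
    rcases Nat.eq_zero_or_pos d with hd0 | hdpos
    · rw [hd0] at hcG hc0 hdegle
      have hqC := eq_C_of_natDegree_le_zero hdegle
      rw [hcG] at hqC
      set c := quadValue M (fun i => (f i).coeff 0) with hc
      rw [hqC, ← dvd_neg, neg_sub] at hf
      have hpe : p = X - C c := by
        obtain ⟨g, hg⟩ := hf
        rcases (irreducible_X_sub_C c).isUnit_or_isUnit hg with h1 | h1
        · exact (hi.not_isUnit h1).elim
        · refine eq_of_monic_of_associated hp (monic_X_sub_C c) ⟨h1.unit, ?_⟩
          simpa using hg.symm
      have hn1 : n = 1 := by rw [← hn, hpe, natDegree_X_sub_C]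
      have : (-1) ^ n * p.coeff 0 = c := by simp [hn1, hpe]
      rw [this]
      exact isGroupValue_quadValue hc0
    obtain ⟨h, hh⟩ := hf
    have hGc : (p * h).coeff (d + d) = quadValue M (fun i => (f i).coeff d) := by
      rw [← hh, coeff_sub, hcG, coeff_X_of_ne_one (by omega), sub_zero]
    have hGdeg : (p * h).natDegree = d + d := by
      refine natDegree_eq_of_le_of_coeff_ne_zero ?_ (hGc ▸ hc0)
      rw [← hh]
      refine (natDegree_sub_le _ _).trans (max_le hdegle ?_)
      rw [natDegree_X]
      omega
    have hh0 : h ≠ 0 := by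
      rintro rfl
      rw [mul_zero, coeff_zero] at hGc
      exact hc0 hGc.symm
    have hlc : IsGroupValue M h.leadingCoeff := by
      have : (p * h).leadingCoeff = h.leadingCoeff := by
        rw [leadingCoeff_mul, hp.leadingCoeff, one_mul]
      rw [← this, leadingCoeff, hGdeg, hGc]
      exact isGroupValue_quadValue hc0
    rw [natDegree_mul hp.ne_zero hh0, hn] at hGdeg
    have hfac : ∀ g : F[X], g ∣ h → g.coeff 0 ≠ 0 → ∀ π : F[X], π.Monic → Irreducible π →
        π ∣ g → IsGroupValue M ((-1) ^ π.natDegree * π.coeff 0) := by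
      intro g hgh hg0 π hπm hπi hπg
      have hπh := hπg.trans hgh
      have := natDegree_le_of_dvd hπh hh0
      refine ih π.natDegree (by omega) hπm hπi (fun h0 => hg0 ?_) (f := f)
        (hh ▸ hπh.mul_left p) rfl
      obtain ⟨r, rfl⟩ := hπg
      rw [mul_coeff_zero, h0, zero_mul]
    have heval := congrArg (eval 0) hh
    rw [eval_sub, eval_X, sub_zero, eval_quadValue, eval_mul, ← coeff_zero_eq_eval_zero,
      ← coeff_zero_eq_eval_zero] at heval
    by_cases hv : quadValue M (fun i => (f i).eval 0) = 0
    · have hX : ∀ i, X ∣ f i := fun i => by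
        rw [X_dvd_iff, coeff_zero_eq_eval_zero]
        exact congrFun (hM _ hv) i
      choose g hg using hX
      rw [hv, eq_comm, mul_eq_zero, or_iff_right hp0, ← X_dvd_iff] at heval
      obtain ⟨r, rfl⟩ := heval
      rw [funext hg, quadValue_mul_left] at hh
      have hpr : p * r = X * quadValue (M.map C) g - 1 := by
        refine mul_left_cancel₀ (X_ne_zero (R := F)) ?_
        rw [mul_left_comm, ← hh]
        ring
      have hprc : p.coeff 0 * r.coeff 0 = -1 := by
        rw [← mul_coeff_zero, hpr]
        simp
      have hr0 : r.coeff 0 ≠ 0 := by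
        intro h0
        simp [h0] at hprc
      have hr := isGroupValue_neg_one_pow_mul_coeff_zero (M := M) (h := r)
        (by simpa using hlc) (hfac r (dvd_mul_left _ _) hr0)
      refine IsGroupValue.of_mul_right ?_ hr
      rw [natDegree_X_mul (right_ne_zero_of_mul hh0)] at hGdeg
      have hodd : Odd (n + r.natDegree) := by
        rw [Nat.odd_iff]
        omega
      rw [mul_mul_mul_comm, ← pow_add, hprc, hodd.neg_one_pow]
      simpa using isGroupValue_one
    · have hh00 : h.coeff 0 ≠ 0 := fun h0 => hv (by rw [heval, h0, mul_zero])
      refine IsGroupValue.of_mul_right ?_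
        (isGroupValue_neg_one_pow_mul_coeff_zero hlc (hfac h dvd_rfl hh00))
      rw [mul_mul_mul_comm, ← pow_add, hGdeg, Even.neg_one_pow ⟨d, rfl⟩, one_mul, ← heval]
      exact isGroupValue_quadValue hv

end Values

section NormPrinciple

/-- A regular quadratic form representing `a` over an odd degree extension represents `a`. -/
lemma exists_quadValue_eq_of_odd_finrank {K L ι : Type*} [Field K] [Field L] [Algebra K L]
    [FiniteDimensional K L] [Fintype ι] [DecidableEq ι] {M : Matrix ι ι K}
    (hreg : (M + M.transpose).det ≠ 0) (ho : Odd (Module.finrank K L)) {a : K} {x : ι → L}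
    (hx : quadValue (M.map (algebraMap K L)) x = algebraMap K L a) :
    ∃ y, quadValue M y = a := by
  by_cases hM : QuadAnisotropic M
  swap
  · exact exists_quadValue_eq_of_not_anisotropic hreg hM a
  have hvalL : quadValue
      ((Matrix.fromBlocks M 0 0 (Matrix.of fun _ _ : Unit => -a)).map (algebraMap K L))
      (Sum.elim x fun _ => 1) = 0 := by
    have hmap : (Matrix.fromBlocks M 0 0 (Matrix.of fun _ _ : Unit => -a)).map (algebraMap K L)
        = Matrix.fromBlocks (M.map (algebraMap K L)) 0 0
          (Matrix.of fun _ _ : Unit => -algebraMap K L a) := by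
      ext (i | i) (j | j) <;> simp
    rw [hmap, quadValue_fromBlocks_neg, hx]
    ring
  by_cases hQ : QuadAnisotropic (Matrix.fromBlocks M 0 0 (Matrix.of fun _ _ : Unit => -a))
  · have := congrFun (hQ.map_of_odd_finrank ho _ hvalL) (Sum.inr ())
    simp at this
  · simp only [QuadAnisotropic, not_forall] at hQ
    obtain ⟨z, hz, hz0⟩ := hQ
    have hze : z = Sum.elim (fun i => z (Sum.inl i)) fun _ => z (Sum.inr ()) := by
      funext i
      rcases i with i | i <;> rfl
    rw [hze, quadValue_fromBlocks_neg, sub_eq_zero] at hz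
    have ht : z (Sum.inr ()) ≠ 0 := by
      intro ht
      rw [ht, zero_pow two_ne_zero, mul_zero] at hz
      have h0 := hM _ hz
      refine hz0 (funext fun i => ?_)
      rcases i with i | i
      · exact congrFun h0 i
      · exact ht
    refine ⟨fun i => (z (Sum.inr ()))⁻¹ * z (Sum.inl i), ?_⟩
    rw [quadValue_mul_left, hz]
    field_simp

lemma QuadAnisotropic.isGroupValue_norm_of_powerBasis {F A : Type*} [Field F] [Field A]
    [Algebra F A] {m : ℕ} {M : Matrix (Fin m) (Fin m) F} (hM : QuadAnisotropic M)
    (pb : PowerBasis F A) (h0 : pb.gen ≠ 0) {x : Fin m → A}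
    (hx : quadValue (M.map (algebraMap F A)) x = pb.gen) :
    IsGroupValue M (Algebra.norm F pb.gen) := by
  choose f hf using fun i => pb.exists_eq_aeval' (x i)
  have h_int := pb.isIntegral_gen
  rw [Algebra.PowerBasis.norm_gen_eq_coeff_zero_minpoly, ← pb.natDegree_minpoly]
  refine hM.isGroupValue_of_dvd (minpoly.monic h_int) (minpoly.irreducible h_int)
    (minpoly.coeff_zero_ne_zero h_int h0) (f := f) ?_
  rw [minpoly.dvd_iff, map_sub, aeval_quadValue, aeval_X, sub_eq_zero]
  exact (congrArg (quadValue _) (funext fun i => (hf i).symm)).trans hx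

lemma QuadAnisotropic.isGroupValue_norm {F L : Type*} [Field F] [Field L] [Algebra F L]
    [FiniteDimensional F L] {m : ℕ} {M : Matrix (Fin m) (Fin m) F}
    (hM : QuadAnisotropic M) (hreg : (M + M.transpose).det ≠ 0) {u : L} (hu : u ≠ 0)
    {x : Fin m → L} (hx : quadValue (M.map (algebraMap F L)) x = u) :
    IsGroupValue M (Algebra.norm F u) := by
  have hnorm : Algebra.norm F u
      = Algebra.norm F (AdjoinSimple.gen F u) ^ Module.finrank F⟮u⟯ L := by
    rw [← map_pow, ← Algebra.norm_algebraMap, Algebra.norm_norm, AdjoinSimple.algebraMap_gen]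
  have hg0 : AdjoinSimple.gen F u ≠ 0 := fun h => hu (by
    rw [← AdjoinSimple.algebraMap_gen F u, h, map_zero])
  have hN0 : Algebra.norm F (AdjoinSimple.gen F u) ≠ 0 := Algebra.norm_ne_zero_iff.mpr hg0
  rw [hnorm]
  rcases Nat.even_or_odd (Module.finrank F⟮u⟯ L) with he | ho
  · obtain ⟨k, hk⟩ := even_iff_two_dvd.mp he
    have hx0 : x ≠ 0 := by
      rintro rfl
      exact hu (hx ▸ quadValue_zero _)
    obtain ⟨i, -⟩ := Function.ne_iff.mp hx0
    have hv : quadValue M (Pi.single i 1) ≠ 0 := fun h => by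
      have := congrFun (hM _ h) i
      simp at this
    rw [hk, pow_mul]
    refine IsGroupValue.pow ?_ k
    refine IsGroupValue.of_mul_right (b := quadValue M (Pi.single i 1)) ?_
      (isGroupValue_quadValue hv)
    rw [← quadValue_mul_left]
    refine isGroupValue_quadValue ?_
    rw [quadValue_mul_left]
    exact mul_ne_zero (pow_ne_zero 2 hN0) hv
  · refine IsGroupValue.pow ?_ _
    have hregE : ((M.map (algebraMap F F⟮u⟯)) + (M.map (algebraMap F F⟮u⟯)).transpose).det
        ≠ 0 := by
      have : (M.map (algebraMap F F⟮u⟯)) + (M.map (algebraMap F F⟮u⟯)).transpose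
          = (algebraMap F F⟮u⟯).mapMatrix (M + M.transpose) := by
        ext i j
        simp
      rw [this, ← RingHom.map_det]
      exact (_root_.map_ne_zero _).mpr hreg
    have hxE : quadValue ((M.map (algebraMap F F⟮u⟯)).map (algebraMap F⟮u⟯ L)) x
        = algebraMap F⟮u⟯ L (AdjoinSimple.gen F u) := by
      rw [AdjoinSimple.algebraMap_gen, Matrix.map_map]
      exact hx
    obtain ⟨y, hy⟩ := exists_quadValue_eq_of_odd_finrank hregE ho hxE
    have h_int := IsIntegral.of_finite F u
    rw [← adjoin.powerBasis_gen h_int] at hy hg0 ⊢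
    exact hM.isGroupValue_norm_of_powerBasis _ hg0 hy

end NormPrinciple

/-- **Knebusch's Norm Principle for fields.** Let `L/F` be a finite field extension and
`q` a regular quadratic form over `F` of rank `m` (coefficient matrix `M`, the associated
symmetric bilinear form `M + Mᵀ` having non-zero determinant). Then
`N_{L/F}(D(q_L)) ⊆ D(q)`. -/
theorem knebusch_norm_principle_fields
    {F L : Type*} [Field F] [Field L] [Algebra F L] [FiniteDimensional F L]
    (m : ℕ) (M : Matrix (Fin m) (Fin m) F)
    (hreg : (M + M.transpose).det ≠ 0)
    (u : Lˣ) (hu : u ∈ valuesSubgroup (M.map (algebraMap F L))) :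
    Units.map (Algebra.norm F : L →* F) u ∈ valuesSubgroup M := by
  revert u
  change valuesSubgroup (M.map (algebraMap F L)) ≤
    (valuesSubgroup M).comap (Units.map (Algebra.norm F : L →* F))
  rw [valuesSubgroup, Subgroup.closure_le]
  rintro u ⟨x, hx⟩
  refine isGroupValue_coe.mp ?_
  rw [Units.coe_map]
  by_cases hM : QuadAnisotropic M
  · exact hM.isGroupValue_norm hreg u.ne_zero hx.symm
  · obtain ⟨y, hy⟩ := exists_quadValue_eq_of_not_anisotropic hreg hM (Algebra.norm F (u : L))
    have h0 : quadValue M y ≠ 0 := hy ▸ Algebra.norm_ne_zero_iff.mpr u.ne_zero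
    exact hy ▸ isGroupValue_quadValue h0
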